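/- Let r < n and let p̃₀, p̃₁, …, p̃_r ∈ [0,1]. Let Y be an abstract simplicial complex on the vertex set {1,…,n} (a collection of subsets of {1,…,n} closed under taking subsets and containing ∅) of dimension at most r, and assume every minimal non-face of Y has cardinality at most r+1. Let I_Y ⊆ S be its Stanley–Reisner ideal. Set D = r+1 and consider the product probability measure on subsets 𝔅 ⊆ M(n,D) under which each squarefree monomial x^α (α ∈ {0,1}ⁿ, α ≠ 0) of degree at most r+1 lies in 𝔅 independently with probability 1 − p̃_{deg(x^α)−1}, and each non-squarefree monomial lies in 𝔅 with probability 0. Then P(⟨𝔅⟩ = I_Y) = ∏_{i=0}^{r} p̃_i^{f_i(Y)} · (1−p̃_i)^{e_i(Y)}, i.e., the probability of obtaining I_Y equals the Costa–Farber probability of the complex Y. -/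

import Mathlib

open Finset MvPolynomial Filter

noncomputable section

/-- The set of exponent vectors of nonconstant monomials in `n` variables of total degree
at most `D`. -/
def monSet (n D : ℕ) : Finset (Fin n → ℕ) :=
  (Fintype.piFinset fun _ : Fin n => Finset.range (D + 1)).filter
    fun α => 0 < ∑ i, α i ∧ ∑ i, α i ≤ D

/-- The monomial `x^α` of `MvPolynomial (Fin n) K` with exponent vector `α`. -/
def mono (K : Type*) [CommRing K] {n : ℕ} (α : Fin n → ℕ) : MvPolynomial (Fin n) K :=
  MvPolynomial.monomial (Finsupp.equivFunOnFinite.symm α) 1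

/-- The monomial ideal generated by a set of exponent vectors. -/
def idealOf (K : Type*) [CommRing K] {n : ℕ} (B : Finset (Fin n → ℕ)) :
    Ideal (MvPolynomial (Fin n) K) :=
  Ideal.span (mono K '' (B : Set (Fin n → ℕ)))

open Classical in
/-- The probability, under the ER-type model `ℐ(n,D,p)`, of the event `E` on random
generating sets `𝔅 ⊆ M(n,D)`. -/
def ERprob (n D : ℕ) (p : ℝ) (E : Set (Finset (Fin n → ℕ))) : ℝ :=
  ∑ B ∈ (monSet n D).powerset.filter (· ∈ E),
    p ^ B.card * (1 - p) ^ ((monSet n D).card - B.card)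

/-- `I` is a monomial ideal. -/
def IsMonomialIdeal (K : Type*) [CommRing K] {n : ℕ}
    (I : Ideal (MvPolynomial (Fin n) K)) : Prop :=
  ∃ G : Set (Fin n → ℕ), I = Ideal.span (mono K '' G)

/-- `x^α` is a minimal monomial generator of `I`: it lies in `I` and no proper divisor does. -/
def IsMinGen (K : Type*) [CommRing K] {n : ℕ} (I : Ideal (MvPolynomial (Fin n) K))
    (α : Fin n → ℕ) : Prop :=
  mono K α ∈ I ∧ ∀ β : Fin n → ℕ, (∀ i, β i ≤ α i) → β ≠ α → mono K β ∉ I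

/-- `β₁(S/I)`: the number of minimal monomial generators of `I`. -/
def beta1 (K : Type*) [CommRing K] {n : ℕ} (I : Ideal (MvPolynomial (Fin n) K)) : ℕ :=
  {α : Fin n → ℕ | IsMinGen K I α}.ncard

/-- `β_{1,d}(S/I)`: the number of minimal monomial generators of `I` of degree `d`. -/
def beta1d (K : Type*) [CommRing K] {n : ℕ} (I : Ideal (MvPolynomial (Fin n) K)) (d : ℕ) : ℕ :=
  {α : Fin n → ℕ | IsMinGen K I α ∧ ∑ i, α i = d}.ncard

/-- `h_I(d)`: the number of monomials of degree exactly `d` not contained in `I`. -/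
def hilb (K : Type*) [CommRing K] {n : ℕ} (I : Ideal (MvPolynomial (Fin n) K)) (d : ℕ) : ℕ :=
  {α : Fin n → ℕ | ∑ i, α i = d ∧ mono K α ∉ I}.ncard

/-- The squarefree exponent vector of a set of variables `τ`: the exponent vector of the
squarefree monomial `∏_{i ∈ τ} xᵢ`. -/
def sqf {n : ℕ} (τ : Finset (Fin n)) : Fin n → ℕ := fun i => if i ∈ τ then 1 else 0

open Classical in
/-- The probability, under the general model (each monomial `x^α ∈ M(n,D)` is included in
the random generating set independently with probability `p α`), of the event `E`. -/
def generalProb (n D : ℕ) (p : (Fin n → ℕ) → ℝ) (E : Set (Finset (Fin n → ℕ))) : ℝ :=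
  ∑ B ∈ (monSet n D).powerset.filter (· ∈ E),
    (∏ α ∈ B, p α) * ∏ α ∈ monSet n D \ B, (1 - p α)

/-- The set of variables dividing the monomial with exponent vector `α`. -/
def expSupport {n : ℕ} (α : Fin n → ℕ) : Finset (Fin n) :=
  Finset.univ.filter fun i => α i ≠ 0

theorem expSupport_sqf {n : ℕ} (τ : Finset (Fin n)) : expSupport (sqf τ) = τ := by
  ext i
  simp [expSupport, sqf]

theorem sqf_injective {n : ℕ} : Function.Injective (sqf (n := n)) := fun σ τ h => by
  rw [← expSupport_sqf σ, h, expSupport_sqf]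

theorem sqf_le_iff {n : ℕ} (τ : Finset (Fin n)) (α : Fin n → ℕ) :
    sqf τ ≤ α ↔ τ ⊆ expSupport α := by
  constructor
  · intro h i hi
    have := h i
    simp only [sqf, hi, if_true] at this
    simp only [expSupport, mem_filter, mem_univ, true_and]
    omega
  · intro h i
    by_cases hi : i ∈ τ
    · have := h hi
      simp only [expSupport, mem_filter, mem_univ, true_and] at this
      simp only [sqf, hi, if_true]
      omega
    · simp [sqf, hi]

theorem sqf_le_one {n : ℕ} (τ : Finset (Fin n)) (i : Fin n) : sqf τ i ≤ 1 := by
  unfold sqf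
  split_ifs <;> omega

theorem sqf_expSupport {n : ℕ} {α : Fin n → ℕ} (h : ∀ i, α i ≤ 1) :
    sqf (expSupport α) = α := by
  funext i
  have := h i
  simp only [sqf, expSupport, mem_filter, mem_univ, true_and]
  split_ifs <;> omega

theorem sum_sqf {n : ℕ} (τ : Finset (Fin n)) : ∑ i, sqf τ i = τ.card := by
  simp [sqf]

theorem mem_monSet {n D : ℕ} {α : Fin n → ℕ} :
    α ∈ monSet n D ↔ 0 < ∑ i, α i ∧ ∑ i, α i ≤ D := by
  simp only [monSet, mem_filter, Fintype.mem_piFinset, Finset.mem_range,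
    and_iff_right_iff_imp]
  rintro ⟨-, h⟩ i
  have := Finset.single_le_sum (f := α) (fun j _ => Nat.zero_le _) (Finset.mem_univ i)
  omega

theorem sqf_mem_monSet {n D : ℕ} {τ : Finset (Fin n)} :
    sqf τ ∈ monSet n D ↔ 0 < τ.card ∧ τ.card ≤ D := by
  rw [mem_monSet, sum_sqf]

theorem mono_mem_span_iff (K : Type*) [Field K] {n : ℕ} (G : Set (Fin n → ℕ))
    (α : Fin n → ℕ) : mono K α ∈ Ideal.span (mono K '' G) ↔ ∃ β ∈ G, β ≤ α := by
  have h : mono K '' G = (fun s => monomial s (1 : K)) ''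
      ((Finsupp.equivFunOnFinite.symm : (Fin n → ℕ) → (Fin n →₀ ℕ)) '' G) := by
    rw [Set.image_image]
    rfl
  classical
  rw [h, mem_ideal_span_monomial_image, mono, support_monomial, if_neg one_ne_zero]
  simp only [Finset.mem_singleton, forall_eq, Set.exists_mem_image]
  rfl

theorem mono_mem_stanleyReisner_iff (K : Type*) [Field K] {n : ℕ}
    {Y : Finset (Finset (Fin n))} (hdown : ∀ σ ∈ Y, ∀ τ ⊆ σ, τ ∈ Y) (α : Fin n → ℕ) :
    mono K α ∈ Ideal.span (mono K '' (sqf '' {τ : Finset (Fin n) | τ ∉ Y})) ↔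
      expSupport α ∉ Y := by
  rw [mono_mem_span_iff]
  simp only [Set.exists_mem_image, Set.mem_ofPred_eq, sqf_le_iff]
  exact ⟨fun ⟨τ, hτ, h⟩ h' => hτ (hdown _ h' _ h), fun h => ⟨_, h, Subset.rfl⟩⟩

theorem exists_minimal_nonface {n : ℕ} {Y : Finset (Finset (Fin n))} (τ : Finset (Fin n)) :
    τ ∉ Y → ∃ ρ ⊆ τ, ρ ∉ Y ∧ ∀ ρ' ⊂ ρ, ρ' ∈ Y := by
  induction τ using Finset.strongInduction with
  | H τ ih =>
    intro hτ
    by_cases h : ∀ τ' ⊂ τ, τ' ∈ Y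
    · exact ⟨τ, Subset.rfl, hτ, h⟩
    · push Not at h
      obtain ⟨τ', hlt, hτ'⟩ := h
      obtain ⟨ρ, hρ, h⟩ := ih τ' hlt hτ'
      exact ⟨ρ, hρ.trans hlt.subset, h⟩

/-- A set of monomials generates the Stanley–Reisner ideal of `Y` exactly when it contains the
monomials of all minimal non-faces and no monomial supported on a face. -/
theorem idealOf_eq_stanleyReisner_iff (K : Type*) [Field K] {n : ℕ}
    {Y : Finset (Finset (Fin n))} (hdown : ∀ σ ∈ Y, ∀ τ ⊆ σ, τ ∈ Y)
    (B : Finset (Fin n → ℕ)) :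
    idealOf K B = Ideal.span (mono K '' (sqf '' {τ : Finset (Fin n) | τ ∉ Y})) ↔
      (∀ τ, τ ∉ Y → (∀ τ' ⊂ τ, τ' ∈ Y) → sqf τ ∈ B) ∧ ∀ α ∈ B, expSupport α ∉ Y := by
  constructor
  · intro h
    have hB : ∀ α ∈ B, expSupport α ∉ Y := fun α hα => by
      rw [← mono_mem_stanleyReisner_iff K hdown, ← h]
      exact Ideal.subset_span ⟨α, hα, rfl⟩
    refine ⟨fun τ hτ hmin => ?_, hB⟩
    have hmem : mono K (sqf τ) ∈ idealOf K B := by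
      rwa [h, mono_mem_stanleyReisner_iff K hdown, expSupport_sqf]
    obtain ⟨β, hβ, hle⟩ := (mono_mem_span_iff K _ _).1 hmem
    have hsub : expSupport β ⊆ τ := by
      rw [← expSupport_sqf τ]
      intro i hi
      have : β i ≤ sqf τ i := hle i
      simp only [expSupport, mem_filter, mem_univ, true_and] at hi ⊢
      omega
    have heq : expSupport β = τ := by
      by_contra hne
      exact hB β hβ (hmin _ (hsub.ssubset_of_ne hne))
    have : sqf τ = β := by
      rw [← heq]
      exact sqf_expSupport fun i => (hle i).trans (sqf_le_one τ i)
    rwa [this]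
  · rintro ⟨hmin, hB⟩
    apply le_antisymm
    · rw [idealOf, Ideal.span_le]
      rintro _ ⟨α, hα, rfl⟩
      exact (mono_mem_stanleyReisner_iff K hdown α).2 (hB α hα)
    · rw [Ideal.span_le]
      rintro _ ⟨_, ⟨τ, hτ, rfl⟩, rfl⟩
      obtain ⟨ρ, hρ, hρY, hρmin⟩ := exists_minimal_nonface τ hτ
      refine (mono_mem_span_iff K _ _).2 ⟨sqf ρ, hmin ρ hρY hρmin, ?_⟩
      rwa [sqf_le_iff, expSupport_sqf]

/-- The probability that the random set contains `m` and is contained in `N`. -/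
theorem generalProb_of_mem_iff_subset {n D : ℕ} (p : (Fin n → ℕ) → ℝ)
    {E : Set (Finset (Fin n → ℕ))} {m N : Finset (Fin n → ℕ)} (hmN : m ⊆ N)
    (hN : N ⊆ monSet n D) (hE : ∀ B ⊆ monSet n D, B ∈ E ↔ m ⊆ B ∧ B ⊆ N) :
    generalProb n D p E = (∏ α ∈ m, p α) * ∏ α ∈ monSet n D \ N, (1 - p α) := by
  classical
  have key := Finset.prod_add (fun α => if α ∈ N then p α else 0)
    (fun α => if α ∈ m then 0 else 1 - p α) (monSet n D)
  have hsum : generalProb n D p E = ∏ α ∈ monSet n D,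
      ((if α ∈ N then p α else 0) + if α ∈ m then 0 else 1 - p α) := by
    rw [key, generalProb, Finset.sum_filter]
    refine Finset.sum_congr rfl fun B hB => ?_
    rw [Finset.mem_powerset] at hB
    split_ifs with h
    · obtain ⟨h1, h2⟩ := (hE B hB).1 h
      congr 1
      · exact Finset.prod_congr rfl fun α hα => by rw [if_pos (h2 hα)]
      · refine Finset.prod_congr rfl fun α hα => ?_
        rw [if_neg fun hm => (Finset.mem_sdiff.1 hα).2 (h1 hm)]
    · rw [hE B hB, not_and_or] at h
      symm
      rcases h with h | h
      · obtain ⟨α, hα, hαB⟩ := Finset.not_subset.1 h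
        exact mul_eq_zero_of_right _ (Finset.prod_eq_zero
          (Finset.mem_sdiff.2 ⟨hN (hmN hα), hαB⟩) (if_pos hα))
      · obtain ⟨α, hα, hαN⟩ := Finset.not_subset.1 h
        exact mul_eq_zero_of_left (Finset.prod_eq_zero hα (if_neg hαN)) _
  rw [hsum, ← Finset.prod_sdiff hN, mul_comm]
  congr 1
  · rw [← Finset.prod_sdiff hmN, Finset.prod_eq_one, one_mul]
    · exact Finset.prod_congr rfl fun α hα => by rw [if_pos (hmN hα), if_pos hα, add_zero]
    · intro α hα
      rw [Finset.mem_sdiff] at hα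
      rw [if_pos hα.1, if_neg hα.2]
      ring
  · refine Finset.prod_congr rfl fun α hα => ?_
    rw [Finset.mem_sdiff] at hα
    rw [if_neg hα.2, if_neg fun h => hα.2 (hmN h), zero_add]

/-- Grouping a product over a family of nonempty sets by cardinality. -/
theorem prod_card_sub_one_eq_prod_pow {n r : ℕ} (A : Finset (Finset (Fin n)))
    (hA : ∀ σ ∈ A, σ.card ≤ r + 1) (f : ℕ → ℝ) :
    ∏ σ ∈ A.filter (fun σ => 0 < σ.card), f (σ.card - 1) =
      ∏ i ∈ Finset.range (r + 1), f i ^ (A.filter fun σ => σ.card = i + 1).card := by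
  rw [← Finset.prod_fiberwise_of_maps_to' (t := Finset.range (r + 1))
    (g := fun σ : Finset (Fin n) => σ.card - 1)]
  · refine Finset.prod_congr rfl fun i _ => ?_
    rw [Finset.prod_const, Finset.filter_filter]
    congr 2
    refine Finset.filter_congr fun σ _ => ?_
    omega
  · intro σ hσ
    have := hA σ (Finset.mem_filter.1 hσ).1
    rw [Finset.mem_range]
    omega

open Classical in
/-- Theorem 5.3. Let `Y` be an abstract simplicial complex on `{1,…,n}`
of dimension at most `r < n` whose minimal non-faces all have cardinality at most `r+1`,
and let `I_Y` be its Stanley–Reisner ideal. With `D = r+1` and the general-model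
probabilities `p_α = 1 - p̃_{deg(x^α)-1}` for squarefree `α ≠ 0` and `p_α = 0` otherwise,
the probability of obtaining `I_Y` equals the Costa–Farber probability
`∏_{i=0}^r p̃_i^{f_i(Y)} (1-p̃_i)^{e_i(Y)}` of the complex `Y`. -/
theorem stmt19 (K : Type*) [Field K] (n r : ℕ) (hn : 1 ≤ n) (hr : r < n)
    (pt : ℕ → ℝ) (hpt : ∀ i ≤ r, 0 ≤ pt i ∧ pt i ≤ 1)
    (Y : Finset (Finset (Fin n)))
    (hempty : ∅ ∈ Y)
    (hdown : ∀ σ ∈ Y, ∀ τ ⊆ σ, τ ∈ Y)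
    (hdim : ∀ σ ∈ Y, σ.card ≤ r + 1)
    (hminnf : ∀ τ : Finset (Fin n), τ ∉ Y → (∀ τ' ⊂ τ, τ' ∈ Y) → τ.card ≤ r + 1) :
    generalProb n (r + 1)
        (fun α => if ∀ i, α i ≤ 1 then 1 - pt ((∑ i, α i) - 1) else 0)
        {B | idealOf K B =
          Ideal.span (mono K '' (sqf '' {τ : Finset (Fin n) | τ ∉ Y}))} =
      ∏ i ∈ Finset.range (r + 1),
        pt i ^ (Y.filter fun σ => σ.card = i + 1).card *
          (1 - pt i) ^ (Finset.univ.filter fun τ : Finset (Fin n) =>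
              τ ∉ Y ∧ (∀ τ' ⊂ τ, τ' ∈ Y) ∧ τ.card = i + 1).card := by
  have hpos : ∀ τ : Finset (Fin n), τ ∉ Y → 0 < τ.card := fun τ hτ =>
    Finset.card_pos.2 (Finset.nonempty_iff_ne_empty.2 fun h => hτ (h ▸ hempty))
  set p : (Fin n → ℕ) → ℝ := fun α => if ∀ i, α i ≤ 1 then 1 - pt ((∑ i, α i) - 1) else 0
    with hp
  have hpsqf : ∀ τ, p (sqf τ) = 1 - pt (τ.card - 1) := fun τ => by
    rw [hp]
    simp only
    rw [if_pos (sqf_le_one τ), sum_sqf]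
  set A : Finset (Finset (Fin n)) :=
    Finset.univ.filter fun τ => τ ∉ Y ∧ ∀ τ' ⊂ τ, τ' ∈ Y with hA
  have hAmem : ∀ τ, τ ∈ A ↔ τ ∉ Y ∧ ∀ τ' ⊂ τ, τ' ∈ Y := fun τ => by simp [hA]
  have hAcard : ∀ τ ∈ A, τ.card ≤ r + 1 := fun τ hτ =>
    hminnf τ ((hAmem τ).1 hτ).1 ((hAmem τ).1 hτ).2
  rw [generalProb_of_mem_iff_subset p (m := A.image sqf)
    (N := (monSet n (r + 1)).filter fun α => expSupport α ∉ Y)]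
  · have hgen : ∏ α ∈ A.image sqf, p α = ∏ i ∈ Finset.range (r + 1),
        (1 - pt i) ^ (A.filter fun τ => τ.card = i + 1).card := by
      rw [Finset.prod_image fun _ _ _ _ h => sqf_injective h,
        ← prod_card_sub_one_eq_prod_pow A hAcard fun i => 1 - pt i,
        Finset.filter_true_of_mem fun τ hτ => hpos τ ((hAmem τ).1 hτ).1]
      exact Finset.prod_congr rfl fun τ _ => hpsqf τ
    have hface : ∏ α ∈ monSet n (r + 1) \ (monSet n (r + 1)).filter (fun α => expSupport α ∉ Y),
        (1 - p α) = ∏ i ∈ Finset.range (r + 1),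
          pt i ^ (Y.filter fun σ => σ.card = i + 1).card := by
      rw [← prod_card_sub_one_eq_prod_pow Y hdim]
      have himage : ∏ σ ∈ Y.filter (fun σ => 0 < σ.card), pt (σ.card - 1) =
          ∏ α ∈ (Y.filter fun σ => 0 < σ.card).image sqf, (1 - p α) := by
        rw [Finset.prod_image fun _ _ _ _ h => sqf_injective h]
        refine Finset.prod_congr rfl fun τ _ => ?_
        rw [hpsqf, sub_sub_cancel]
      rw [himage]
      symm
      apply Finset.prod_subset
      · intro α hα
        obtain ⟨σ, hσ, rfl⟩ := Finset.mem_image.1 hα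
        obtain ⟨hσY, hσ0⟩ := Finset.mem_filter.1 hσ
        simp only [Finset.mem_sdiff, Finset.mem_filter, expSupport_sqf, sqf_mem_monSet]
        exact ⟨⟨hσ0, hdim σ hσY⟩, fun h => h.2 hσY⟩
      · intro α hα hnot
        simp only [Finset.mem_sdiff, Finset.mem_filter, not_and, not_not] at hα
        have hns : ¬ ∀ i, α i ≤ 1 := fun h => by
          have hs := sqf_expSupport h
          have hm := hα.1
          rw [← hs, sqf_mem_monSet] at hm
          exact hnot (Finset.mem_image.2
            ⟨_, Finset.mem_filter.2 ⟨hα.2 hα.1, hm.1⟩, hs⟩)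
        rw [hp]
        simp only
        rw [if_neg hns, sub_zero]
    rw [hgen, hface, ← Finset.prod_mul_distrib]
    refine Finset.prod_congr rfl fun i _ => ?_
    rw [mul_comm, hA, Finset.filter_filter]
    simp only [and_assoc]
  · intro α hα
    obtain ⟨τ, hτ, rfl⟩ := Finset.mem_image.1 hα
    have hτY := ((hAmem τ).1 hτ).1
    rw [Finset.mem_filter, sqf_mem_monSet, expSupport_sqf]
    exact ⟨⟨hpos τ hτY, hAcard τ hτ⟩, hτY⟩
  · exact Finset.filter_subset _ _
  · intro B hB
    rw [Set.mem_ofPred_eq, idealOf_eq_stanleyReisner_iff K hdown]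
    refine and_congr ?_ ?_
    · simp only [Finset.image_subset_iff, hAmem, and_imp]
    · exact ⟨fun h α hα => Finset.mem_filter.2 ⟨hB hα, h α hα⟩,
        fun h α hα => (Finset.mem_filter.1 (h hα)).2⟩

end
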